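/- arXiv:1404.4203 — 2 statements merged into one kernel-verified Lean document; each statement's English description precedes it below -/
import Mathlib

section
/- Let U ∈ C₀^∞(Ω̄∖M) and V_t ∈ C^∞(Ω̄_t∖M) for t = 1,2. Then the following nonlocal Green formula in the dihedral angle Ω holds: Σ_{t=1,2} ∫_{Ω_t} (−ΔU)·conj(V_t) dx + ∫_{Γ₁} ( ∂U/∂n₁ + α·(∂U/∂r)(χ₁₂ r, φ+φ₁₂, z) )·conj(−V₁) dΓ + ∫_{Γ₃} (∂U/∂n₃)·conj(−V₂) dΓ + ∫_{Γ₂} (∂U/∂n₂)·(conj(V₁) − conj(V₂)) dΓ = Σ_{t=1,2} ∫_{Ω_t} U·conj(−ΔV_t) dx + ∫_{Γ₁} (−U)·conj(∂V₁/∂n₁) dΓ + ∫_{Γ₃} (−U)·conj(∂V₂/∂n₃) dΓ + ∫_{Γ₂} U·conj( ∂V₁/∂n₂ − ∂V₂/∂n₂ + α·(χ'₂₁)²·(∂V₁/∂r)(χ'₂₁ r, φ+φ'₂₁, z) ) dΓ. -/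
open MeasureTheory Real Set ComplexConjugate

noncomputable section

/-- Open plane sector `{(r cos θ, r sin θ) : r > 0, a < θ < b}` (polar coordinates). -/
def sector (a b : ℝ) : Set (ℝ × ℝ) :=
  {y | ∃ r θ : ℝ, 0 < r ∧ a < θ ∧ θ < b ∧ y = (r * Real.cos θ, r * Real.sin θ)}

variable (d : ℕ)

/-- The dihedral angle `K × ℝ^d` over a plane sector. -/
def dihedral (a b : ℝ) : Set ((ℝ × ℝ) × (Fin d → ℝ)) :=
  (sector a b) ×ˢ (Set.univ : Set (Fin d → ℝ))

/-- The edge `M = {y = 0} × ℝ^d`. -/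
def edge : Set ((ℝ × ℝ) × (Fin d → ℝ)) :=
  ({0} : Set (ℝ × ℝ)) ×ˢ (Set.univ : Set (Fin d → ℝ))

/-- Directional derivative of `W` in a fixed direction `v`. -/
def dd3 (W : (ℝ × ℝ) × (Fin d → ℝ) → ℂ) (v : (ℝ × ℝ) × (Fin d → ℝ))
    (x : (ℝ × ℝ) × (Fin d → ℝ)) : ℂ := fderiv ℝ W x v

/-- Laplacian in all `2 + d` variables. -/
def lap3 (W : (ℝ × ℝ) × (Fin d → ℝ) → ℂ) (x : (ℝ × ℝ) × (Fin d → ℝ)) : ℂ :=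
  dd3 d (dd3 d W ((1, 0), 0)) ((1, 0), 0) x +
  dd3 d (dd3 d W ((0, 1), 0)) ((0, 1), 0) x +
  ∑ i : Fin d, dd3 d (dd3 d W (0, Pi.single i 1)) (0, Pi.single i 1) x

/-- Rotation by the angle `ψ` and dilation by the factor `χ`, acting in the `y`-plane only:
in cylindrical coordinates `(r, φ, z) ↦ (χ r, φ + ψ, z)`. -/
def rotDilY (χ ψ : ℝ) (x : (ℝ × ℝ) × (Fin d → ℝ)) : (ℝ × ℝ) × (Fin d → ℝ) :=
  ((χ * (x.1.1 * Real.cos ψ - x.1.2 * Real.sin ψ),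
    χ * (x.1.1 * Real.sin ψ + x.1.2 * Real.cos ψ)), x.2)

/-- Integral over the half-plane `Γ = γ × ℝ^d`, `γ = {φ = b}`:
`∫_Γ h dΓ = ∫_{ℝ^d} ∫₀^∞ h(r, b, z) dr dz`. -/
def faceInt (b : ℝ) (h : (ℝ × ℝ) × (Fin d → ℝ) → ℂ) : ℂ :=
  ∫ z : Fin d → ℝ, ∫ r in Set.Ioi (0 : ℝ), h ((r * Real.cos b, r * Real.sin b), z)

/-- `W` is smooth on an open neighbourhood of the set `s`
(the formalization of `W ∈ C^∞(s)` for a non-open `s`). -/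
def SmoothNear3 (W : (ℝ × ℝ) × (Fin d → ℝ) → ℂ) (s : Set ((ℝ × ℝ) × (Fin d → ℝ))) : Prop :=
  ∃ O : Set ((ℝ × ℝ) × (Fin d → ℝ)), IsOpen O ∧ s ⊆ O ∧ ContDiffOn ℝ (⊤ : ℕ∞) W O

section Planar

lemma HasCompactSupport.comp_leftInverse {X Y E : Type*} [TopologicalSpace X] [TopologicalSpace Y]
    [T2Space Y] [Zero E] {f : Y → E} (hf : HasCompactSupport f) {g : X → Y} {k : Y → X}
    [T2Space X] (h : Function.LeftInverse k g) (hk : Continuous k) (hg : Continuous g) :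
    HasCompactSupport (fun x => f (g x)) :=
  hf.comp_isClosedEmbedding (h.isClosedEmbedding hk hg)

lemma HasCompactSupport.exists_le {X E : Type*} [TopologicalSpace X] [Zero E] {f : X → E}
    (hf : HasCompactSupport f) {g : X → ℝ} (hg : Continuous g) :
    ∃ R : ℝ, ∀ x, R < g x → f x = 0 := by
  obtain ⟨R, hR⟩ := hf.isCompact.bddAbove_image (f := g) hg.continuousOn
  refine ⟨R, fun x hx => ?_⟩
  by_contra h
  exact absurd (hR ⟨x, subset_tsupport _ h, rfl⟩) (not_le.2 hx)

lemma leftInverse_ray (b : ℝ) : Function.LeftInverse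
    (fun y : ℝ × ℝ => y.1 * cos b + y.2 * sin b) (fun r : ℝ => (r * cos b, r * sin b)) := by
  intro r
  have := sin_sq_add_cos_sq b
  simp only
  linear_combination r * this

lemma sector_eq_image (a b : ℝ) : sector a b = polarCoord.symm '' (Ioi 0 ×ˢ Ioo a b) := by
  ext y
  simp only [sector, mem_ofPred_eq, mem_image, Prod.exists, mem_prod, mem_Ioi, mem_Ioo,
    polarCoord_symm_apply]
  constructor
  · rintro ⟨r, θ, h1, h2, h3, rfl⟩
    exact ⟨r, θ, ⟨h1, h2, h3⟩, rfl⟩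
  · rintro ⟨r, θ, ⟨h1, h2, h3⟩, rfl⟩
    exact ⟨r, θ, h1, h2, h3, rfl⟩

lemma injOn_polarCoord_symm {a b : ℝ} (hab : b ≤ a + 2 * π) :
    InjOn polarCoord.symm (Ioi (0 : ℝ) ×ˢ Ioo a b) := by
  rintro ⟨r, θ⟩ ⟨hr, hθ⟩ ⟨s, ψ⟩ ⟨hs, hψ⟩ h
  simp only [mem_Ioi, mem_Ioo, polarCoord_symm_apply, Prod.mk.injEq] at *
  obtain ⟨h1, h2⟩ := h
  have hrs : r = s := by
    have : r ^ 2 = s ^ 2 := by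
      linear_combination (-r ^ 2) * sin_sq_add_cos_sq θ + s ^ 2 * sin_sq_add_cos_sq ψ +
        (r * cos θ + s * cos ψ) * h1 + (r * sin θ + s * sin ψ) * h2
    exact (pow_left_inj₀ hr.le hs.le two_ne_zero).1 this
  subst hrs
  have hc := mul_left_cancel₀ hr.ne' h1
  have hsn := mul_left_cancel₀ hr.ne' h2
  have hA := Real.Angle.cos_sin_inj hc hsn
  rw [Real.Angle.angle_eq_iff_two_pi_dvd_sub] at hA
  obtain ⟨k, hk⟩ := hA
  have hp := Real.pi_pos
  have h3 : (k : ℝ) < 1 := by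
    by_contra! h
    nlinarith
  have h4 : (-1 : ℝ) < k := by
    by_contra! h
    nlinarith
  have : k = 0 := by
    have h3' : k < 1 := by exact_mod_cast h3
    have h4' : -1 < k := by exact_mod_cast h4
    omega
  subst this
  simp at hk
  exact ⟨rfl, by linarith⟩

lemma measurableSet_sector {a b : ℝ} (hab : b ≤ a + 2 * π) : MeasurableSet (sector a b) := by
  rw [sector_eq_image]
  exact measurable_image_of_fderivWithin (measurableSet_Ioi.prod measurableSet_Ioo)
    (fun x _ => (hasFDerivAt_polarCoord_symm x).hasFDerivWithinAt) (injOn_polarCoord_symm hab)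

lemma integral_sector {a b : ℝ} (hab : b ≤ a + 2 * π) (g : ℝ × ℝ → ℂ) :
    ∫ y in sector a b, g y =
      ∫ p in Ioi (0 : ℝ) ×ˢ Ioo a b, (p.1 : ℂ) * g (p.1 * cos p.2, p.1 * sin p.2) := by
  have hm : MeasurableSet (Ioi (0 : ℝ) ×ˢ Ioo a b) := measurableSet_Ioi.prod measurableSet_Ioo
  rw [sector_eq_image, integral_image_eq_integral_abs_det_fderiv_smul volume hm
    (fun x _ => (hasFDerivAt_polarCoord_symm x).hasFDerivWithinAt) (injOn_polarCoord_symm hab)]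
  refine setIntegral_congr_fun hm fun p hp => ?_
  simp only [det_fderivPolarCoordSymm, polarCoord_symm_apply, Complex.real_smul]
  rw [abs_of_pos hp.1]

lemma integrableOn_halfStrip {a b R : ℝ} {k : ℝ × ℝ → ℂ} (hk : Continuous k)
    (hR : ∀ p : ℝ × ℝ, R < p.1 → k p = 0) :
    IntegrableOn k (Ioi (0 : ℝ) ×ˢ Ioo a b) := by
  have h : IntegrableOn k (Icc 0 R ×ˢ Icc a b) :=
    hk.continuousOn.integrableOn_compact (isCompact_Icc.prod isCompact_Icc)
  refine h.of_forall_sdiff_eq_zero (measurableSet_Ioi.prod measurableSet_Ioo) ?_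
  rintro ⟨r, θ⟩ ⟨⟨h1, h2⟩, h3⟩
  refine hR _ ?_
  by_contra! h
  exact h3 ⟨⟨le_of_lt h1, h⟩, ⟨h2.1.le, h2.2.le⟩⟩

lemma hasDerivAt_comp_radial {p : ℝ × ℝ → ℂ} (hp : Differentiable ℝ p) (r θ : ℝ) :
    HasDerivAt (fun r : ℝ => p (r * cos θ, r * sin θ))
      (cos θ * fderiv ℝ p (r * cos θ, r * sin θ) (1, 0) +
        sin θ * fderiv ℝ p (r * cos θ, r * sin θ) (0, 1)) r := by
  have h := (hp (r * cos θ, r * sin θ)).hasFDerivAt.comp_hasDerivAt r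
    (((hasDerivAt_id r).mul_const (cos θ)).prodMk ((hasDerivAt_id r).mul_const (sin θ)))
  convert! h using 1
  have : ((1 * cos θ, 1 * sin θ) : ℝ × ℝ) = cos θ • ((1, 0) : ℝ × ℝ) + sin θ • ((0, 1) : ℝ × ℝ) := by
    simp
  rw [this, map_add, map_smul, map_smul, Complex.real_smul, Complex.real_smul]

lemma hasDerivAt_comp_angular {p : ℝ × ℝ → ℂ} (hp : Differentiable ℝ p) (r θ : ℝ) :
    HasDerivAt (fun θ : ℝ => p (r * cos θ, r * sin θ))
      (-(r * sin θ) * fderiv ℝ p (r * cos θ, r * sin θ) (1, 0) +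
        r * cos θ * fderiv ℝ p (r * cos θ, r * sin θ) (0, 1)) θ := by
  have h := (hp (r * cos θ, r * sin θ)).hasFDerivAt.comp_hasDerivAt θ
    (((hasDerivAt_cos θ).const_mul r).prodMk ((hasDerivAt_sin θ).const_mul r))
  convert! h using 1
  have : ((r * -sin θ, r * cos θ) : ℝ × ℝ) =
      (-(r * sin θ)) • ((1, 0) : ℝ × ℝ) + (r * cos θ) • ((0, 1) : ℝ × ℝ) := by
    simp
  rw [this, map_add, map_smul, map_smul, Complex.real_smul, Complex.real_smul]
  push_cast
  ring

/-- Divergence theorem in a plane sector. -/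
lemma integral_sector_divergence {a b : ℝ} (hab : a ≤ b) (hba : b ≤ a + 2 * π) {p q : ℝ × ℝ → ℂ}
    (hp : ContDiff ℝ 1 p) (hq : ContDiff ℝ 1 q)
    (hpc : HasCompactSupport p) (hqc : HasCompactSupport q) :
    ∫ y in sector a b, (fderiv ℝ p y (1, 0) + fderiv ℝ q y (0, 1)) =
      (∫ r in Ioi (0 : ℝ), (-sin b * p (r * cos b, r * sin b) +
        cos b * q (r * cos b, r * sin b))) -
      ∫ r in Ioi (0 : ℝ), (-sin a * p (r * cos a, r * sin a) +
        cos a * q (r * cos a, r * sin a)) := by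
  have hpd := hp.differentiable one_ne_zero
  have hqd := hq.differentiable one_ne_zero
  have hpf : Continuous (fderiv ℝ p) := hp.continuous_fderiv one_ne_zero
  have hqf : Continuous (fderiv ℝ q) := hq.continuous_fderiv one_ne_zero
  have hpcont := hp.continuous
  have hqcont := hq.continuous
  set H : ℝ → ℝ → ℂ := fun r θ => -sin θ * p (r * cos θ, r * sin θ) +
    cos θ * q (r * cos θ, r * sin θ) with hH
  set G : ℝ → ℝ → ℂ := fun r θ => r * (cos θ * p (r * cos θ, r * sin θ) +
    sin θ * q (r * cos θ, r * sin θ)) with hG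
  set p1 : ℝ × ℝ → ℂ := fun y => fderiv ℝ p y (1, 0) with hp1
  set p2 : ℝ × ℝ → ℂ := fun y => fderiv ℝ p y (0, 1) with hp2
  set q1 : ℝ × ℝ → ℂ := fun y => fderiv ℝ q y (1, 0) with hq1
  set q2 : ℝ × ℝ → ℂ := fun y => fderiv ℝ q y (0, 1) with hq2
  have cp1 : Continuous p1 := hpf.clm_apply continuous_const
  have cp2 : Continuous p2 := hpf.clm_apply continuous_const
  have cq1 : Continuous q1 := hqf.clm_apply continuous_const
  have cq2 : Continuous q2 := hqf.clm_apply continuous_const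
  set H' : ℝ × ℝ → ℂ := fun x =>
    -cos x.2 * p (x.1 * cos x.2, x.1 * sin x.2) - sin x.2 * q (x.1 * cos x.2, x.1 * sin x.2) +
    (-sin x.2 * (-(x.1 * sin x.2) * p1 (x.1 * cos x.2, x.1 * sin x.2) +
        x.1 * cos x.2 * p2 (x.1 * cos x.2, x.1 * sin x.2)) +
      cos x.2 * (-(x.1 * sin x.2) * q1 (x.1 * cos x.2, x.1 * sin x.2) +
        x.1 * cos x.2 * q2 (x.1 * cos x.2, x.1 * sin x.2))) with hH'
  set G' : ℝ × ℝ → ℂ := fun x =>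
    cos x.2 * p (x.1 * cos x.2, x.1 * sin x.2) + sin x.2 * q (x.1 * cos x.2, x.1 * sin x.2) +
    x.1 * (cos x.2 * (cos x.2 * p1 (x.1 * cos x.2, x.1 * sin x.2) +
        sin x.2 * p2 (x.1 * cos x.2, x.1 * sin x.2)) +
      sin x.2 * (cos x.2 * q1 (x.1 * cos x.2, x.1 * sin x.2) +
        sin x.2 * q2 (x.1 * cos x.2, x.1 * sin x.2))) with hG'
  have hHd : ∀ r θ, HasDerivAt (H r) (H' (r, θ)) θ := by
    intro r θ
    have h1 := ((hasDerivAt_sin θ).ofReal_comp.neg).mul (hasDerivAt_comp_angular hpd r θ)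
    have h2 := ((hasDerivAt_cos θ).ofReal_comp).mul (hasDerivAt_comp_angular hqd r θ)
    convert! h1.add h2 using 1
    simp only [hH', hp1, hp2, hq1, hq2, Pi.neg_apply]
    push_cast
    ring
  have hGd : ∀ r θ, HasDerivAt (fun r => G r θ) (G' (r, θ)) r := by
    intro r θ
    have h1 := ((hasDerivAt_comp_radial hpd r θ).const_mul (cos θ : ℂ)).add
      ((hasDerivAt_comp_radial hqd r θ).const_mul (sin θ : ℂ))
    convert! ((hasDerivAt_id r).ofReal_comp).mul h1 using 1
    simp only [hG', hp1, hp2, hq1, hq2, Pi.add_apply, id]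
    push_cast
    ring
  have hray : Continuous (fun x : ℝ × ℝ => ((x.1 * cos x.2, x.1 * sin x.2) : ℝ × ℝ)) := by
    fun_prop
  have cpr := hpcont.comp hray
  have cqr := hqcont.comp hray
  have cp1r := cp1.comp hray
  have cp2r := cp2.comp hray
  have cq1r := cq1.comp hray
  have cq2r := cq2.comp hray
  simp only [Function.comp_def] at cpr cqr cp1r cp2r cq1r cq2r
  have hH'c : Continuous H' := by
    simp only [hH']
    fun_prop
  have hG'c : Continuous G' := by
    simp only [hG']
    fun_prop
  have hbound : ∀ f : ℝ × ℝ → ℂ, HasCompactSupport f → ∃ R : ℝ, ∀ x : ℝ × ℝ, R < x.1 →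
      f (x.1 * cos x.2, x.1 * sin x.2) = 0 := by
    intro f hf
    obtain ⟨R, hR⟩ := hf.exists_le (g := fun y => y.1 ^ 2 + y.2 ^ 2) (by fun_prop)
    refine ⟨|R| + 1, fun x hx => hR _ ?_⟩
    have : (x.1 * cos x.2) ^ 2 + (x.1 * sin x.2) ^ 2 = x.1 ^ 2 := by
      linear_combination x.1 ^ 2 * sin_sq_add_cos_sq x.2
    simp only [this]
    nlinarith [abs_nonneg R, le_abs_self R]
  obtain ⟨R1, hR1⟩ := hbound p hpc
  obtain ⟨R2, hR2⟩ := hbound q hqc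
  obtain ⟨R3, hR3⟩ := hbound p1 (hpc.fderiv_apply ℝ _)
  obtain ⟨R4, hR4⟩ := hbound p2 (hpc.fderiv_apply ℝ _)
  obtain ⟨R5, hR5⟩ := hbound q1 (hqc.fderiv_apply ℝ _)
  obtain ⟨R6, hR6⟩ := hbound q2 (hqc.fderiv_apply ℝ _)
  obtain ⟨R, hR⟩ : ∃ R, R1 ≤ R ∧ R2 ≤ R ∧ R3 ≤ R ∧ R4 ≤ R ∧ R5 ≤ R ∧ R6 ≤ R :=
    ⟨max R1 (max R2 (max R3 (max R4 (max R5 R6)))), by simp⟩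
  obtain ⟨l1, l2, l3, l4, l5, l6⟩ := hR
  have hH'i : IntegrableOn H' (Ioi (0 : ℝ) ×ˢ Ioo a b) := by
    refine integrableOn_halfStrip (R := R) hH'c fun x hx => ?_
    simp only [hH']
    rw [hR1 x (by linarith), hR2 x (by linarith), hR3 x (by linarith), hR4 x (by linarith),
      hR5 x (by linarith), hR6 x (by linarith)]
    simp
  have hG'i : IntegrableOn G' (Ioi (0 : ℝ) ×ˢ Ioo a b) := by
    refine integrableOn_halfStrip (R := R) hG'c fun x hx => ?_
    simp only [hG']
    rw [hR1 x (by linarith), hR2 x (by linarith), hR3 x (by linarith), hR4 x (by linarith),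
      hR5 x (by linarith), hR6 x (by linarith)]
    simp
  have hcs : ∀ f : ℝ × ℝ → ℂ, HasCompactSupport f → ∀ θ,
      HasCompactSupport (fun r : ℝ => f (r * cos θ, r * sin θ)) := fun f hf θ =>
    hf.comp_leftInverse (leftInverse_ray θ) (by fun_prop) (by fun_prop)
  have hHi : ∀ θ, IntegrableOn (fun r => H r θ) (Ioi 0) := fun θ => by
    have c1 : Continuous (fun r => H r θ) := by
      simp only [hH]
      fun_prop
    exact (c1.integrable_of_hasCompactSupport
      (((hcs p hpc θ).mul_left).add ((hcs q hqc θ).mul_left))).integrableOn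
  have hG0 : ∀ θ, ∫ r in Ioi (0 : ℝ), G' (r, θ) = 0 := fun θ => by
    have hc : HasCompactSupport (fun r => G r θ) :=
      (((hcs p hpc θ).mul_left).add ((hcs q hqc θ).mul_left)).mul_left
    have hd : deriv (fun r => G r θ) = fun r => G' (r, θ) := funext fun r => (hGd r θ).deriv
    have hs : ContDiff ℝ 1 (fun r => G r θ) := by
      rw [contDiff_one_iff_deriv, hd]
      exact ⟨fun r => (hGd r θ).differentiableAt, by fun_prop⟩
    have := hc.integral_Ioi_deriv_eq hs 0
    rw [hd] at this
    rw [this]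
    simp [hG]
  rw [integral_sector hba]
  have hsplit : ∀ x : ℝ × ℝ, (x.1 : ℂ) * (fderiv ℝ p (x.1 * cos x.2, x.1 * sin x.2) (1, 0) +
      fderiv ℝ q (x.1 * cos x.2, x.1 * sin x.2) (0, 1)) = G' x + H' x := by
    intro x
    have := sin_sq_add_cos_sq x.2
    have h2 : (sin x.2 : ℂ) ^ 2 + (cos x.2 : ℂ) ^ 2 = 1 := by exact_mod_cast this
    simp only [hG', hH', hp1, hq2]
    linear_combination (-x.1 * (fderiv ℝ p (x.1 * cos x.2, x.1 * sin x.2) (1, 0) +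
      fderiv ℝ q (x.1 * cos x.2, x.1 * sin x.2) (0, 1))) * h2
  simp_rw [hsplit]
  rw [integral_add hG'i hH'i]
  have e1 : ∫ x in Ioi (0 : ℝ) ×ˢ Ioo a b, G' x = 0 := by
    rw [Measure.volume_eq_prod] at hG'i ⊢
    rw [← setIntegral_prod_swap, setIntegral_prod]
    · simp [hG0]
    · exact (hG'i.swap : _)
  have e2 : ∫ x in Ioi (0 : ℝ) ×ˢ Ioo a b, H' x = ∫ r in Ioi (0 : ℝ), (H r b - H r a) := by
    rw [Measure.volume_eq_prod] at hH'i ⊢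
    rw [setIntegral_prod _ hH'i]
    refine setIntegral_congr_fun measurableSet_Ioi fun r _ => ?_
    rw [← integral_Ioc_eq_integral_Ioo, ← intervalIntegral.integral_of_le hab]
    refine intervalIntegral.integral_eq_sub_of_hasDerivAt (fun θ _ => hHd r θ) ?_
    exact (by fun_prop : Continuous fun θ => H' (r, θ)).intervalIntegrable _ _
  rw [e1, e2, zero_add, integral_sub (hHi b) (hHi a)]

end Planar

section Test

variable {d}

/-- Smooth complex-valued functions with compact support. -/
structure IsTest (f : (ℝ × ℝ) × (Fin d → ℝ) → ℂ) : Prop where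
  smooth : ContDiff ℝ (⊤ : ℕ∞) f
  compact : HasCompactSupport f

namespace IsTest

variable {f g : (ℝ × ℝ) × (Fin d → ℝ) → ℂ}

lemma continuous (hf : IsTest f) : Continuous f := hf.smooth.continuous

lemma differentiable (hf : IsTest f) : Differentiable ℝ f := hf.smooth.differentiable (by simp)

lemma integrable (hf : IsTest f) : Integrable f :=
  hf.continuous.integrable_of_hasCompactSupport hf.compact

lemma add (hf : IsTest f) (hg : IsTest g) : IsTest (fun x => f x + g x) :=
  ⟨hf.smooth.add hg.smooth, hf.compact.add hg.compact⟩

lemma neg (hf : IsTest f) : IsTest (fun x => -f x) :=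
  ⟨hf.smooth.neg, hf.compact.neg⟩

lemma sub (hf : IsTest f) (hg : IsTest g) : IsTest (fun x => f x - g x) := by
  simpa only [sub_eq_add_neg] using hf.add hg.neg

lemma mul_left (hg : IsTest g) (hf : ContDiff ℝ (⊤ : ℕ∞) f) : IsTest (fun x => f x * g x) :=
  ⟨hf.mul hg.smooth, hg.compact.mul_left⟩

lemma mul_right (hf : IsTest f) (hg : ContDiff ℝ (⊤ : ℕ∞) g) : IsTest (fun x => f x * g x) :=
  ⟨hf.smooth.mul hg, hf.compact.mul_right⟩

lemma mul (hf : IsTest f) (hg : IsTest g) : IsTest (fun x => f x * g x) :=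
  hf.mul_right hg.smooth

lemma const_mul (hf : IsTest f) (c : ℂ) : IsTest (fun x => c * f x) :=
  hf.mul_left contDiff_const

lemma dd3 (hf : IsTest f) (v : (ℝ × ℝ) × (Fin d → ℝ)) : IsTest (dd3 d f v) :=
  ⟨(hf.smooth.fderiv_right (m := (⊤ : ℕ∞)) (by simp)).clm_apply contDiff_const,
    hf.compact.fderiv_apply ℝ v⟩

lemma sum {ι : Type*} (s : Finset ι) {F : ι → (ℝ × ℝ) × (Fin d → ℝ) → ℂ}
    (hF : ∀ i, IsTest (F i)) : IsTest (fun x => ∑ i ∈ s, F i x) := by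
  classical
  induction s using Finset.induction_on with
  | empty => exact ⟨by simpa using contDiff_const, by
    simp only [Finset.sum_empty]
    exact HasCompactSupport.zero⟩
  | insert i s hi ih => simpa only [Finset.sum_insert hi] using (hF i).add ih

lemma lap3 (hf : IsTest f) : IsTest (lap3 d f) :=
  (((hf.dd3 _).dd3 _).add ((hf.dd3 _).dd3 _)).add (IsTest.sum _ fun _ => (hf.dd3 _).dd3 _)

lemma star (hf : IsTest f) : IsTest (fun x => conj (f x)) :=
  ⟨Complex.conjCLE.contDiff.comp hf.smooth, hf.compact.comp_left (map_zero _)⟩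

end IsTest

variable {f g : (ℝ × ℝ) × (Fin d → ℝ) → ℂ}

lemma dd3_conj (hf : IsTest f) (v : (ℝ × ℝ) × (Fin d → ℝ)) :
    dd3 d (fun x => conj (f x)) v = fun x => conj (dd3 d f v x) := by
  funext x
  have h := (Complex.conjCLE.toContinuousLinearMap.hasFDerivAt (x := f x)).comp x
    (hf.differentiable x).hasFDerivAt
  have h2 : fderiv ℝ (fun x => conj (f x)) x = _ := h.fderiv
  simp only [dd3]
  rw [h2]
  rfl

lemma lap3_conj (hf : IsTest f) (x : (ℝ × ℝ) × (Fin d → ℝ)) :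
    lap3 d (fun x => conj (f x)) x = conj (lap3 d f x) := by
  simp only [lap3, dd3_conj hf, dd3_conj (hf.dd3 _), map_add, map_sum]

lemma dd3_congr {x : (ℝ × ℝ) × (Fin d → ℝ)}
    (v : (ℝ × ℝ) × (Fin d → ℝ)) (h : f =ᶠ[nhds x] g) : dd3 d f v =ᶠ[nhds x] dd3 d g v := by
  filter_upwards [h.fderiv (𝕜 := ℝ)] with y hy
  simp only [dd3, hy]

lemma lap3_congr {x : (ℝ × ℝ) × (Fin d → ℝ)} (h : f =ᶠ[nhds x] g) :
    lap3 d f x = lap3 d g x := by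
  simp only [lap3]
  congr 1
  · rw [(dd3_congr _ (dd3_congr _ h)).eq_of_nhds, (dd3_congr _ (dd3_congr _ h)).eq_of_nhds]
  · exact Finset.sum_congr rfl fun i _ => (dd3_congr _ (dd3_congr _ h)).eq_of_nhds

lemma dd3_fst_eq (a b : ℝ) (x : (ℝ × ℝ) × (Fin d → ℝ)) :
    dd3 d f ((a, b), 0) x = a * dd3 d f ((1, 0), 0) x + b * dd3 d f ((0, 1), 0) x := by
  have : (((a, b), 0) : (ℝ × ℝ) × (Fin d → ℝ)) = a • ((1, 0), 0) + b • ((0, 1), 0) := by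
    ext <;> simp
  simp only [dd3]
  rw [this, map_add, map_smul, map_smul, Complex.real_smul, Complex.real_smul]

/-- Germs of a function smooth near a compact set are realized by a compactly supported one. -/
lemma exists_isTest_eventuallyEq {O K : Set ((ℝ × ℝ) × (Fin d → ℝ))} (hO : IsOpen O)
    (hK : IsCompact K) (hKO : K ⊆ O) (hf : ContDiffOn ℝ (⊤ : ℕ∞) f O) :
    ∃ g, IsTest g ∧ (∀ x ∈ K, g =ᶠ[nhds x] f) ∧ ∀ x, f x = 0 → g x = 0 := by
  obtain ⟨L, hL, hKL, hLO⟩ := exists_compact_between hK hO hKO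
  obtain ⟨ψ, h1, h0, -⟩ := exists_contMDiffMap_one_nhds_of_subset_interior
    (n := (⊤ : ℕ∞)) (modelWithCornersSelf ℝ ((ℝ × ℝ) × (Fin d → ℝ))) hK.isClosed hKL
  have hψ : ContDiff ℝ (⊤ : ℕ∞) ψ := ψ.contMDiff.contDiff
  have hz : ∀ x ∉ L, (ψ x : ℂ) * f x = 0 := fun x hx => by simp [h0 x hx]
  refine ⟨fun x => (ψ x : ℂ) * f x, ⟨?_, HasCompactSupport.intro hL hz⟩, ?_, ?_⟩
  · rw [contDiff_iff_contDiffAt]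
    intro x
    by_cases hx : x ∈ L
    · exact (Complex.ofRealCLM.contDiff.comp hψ).contDiffAt.mul
        (hf.contDiffAt (hO.mem_nhds (hLO hx)))
    · refine (contDiffAt_const (c := (0 : ℂ))).congr_of_eventuallyEq ?_
      filter_upwards [hL.isClosed.isOpen_compl.mem_nhds hx] with y hy using hz y hy
  · intro x hx
    filter_upwards [(eventually_nhdsSet_iff_forall.1 h1) x hx] with y hy
    simp [hy]
  · intro x hx
    simp [hx]

lemma IsTest.integrable_comp_ray (hf : IsTest f) (b : ℝ) :
    Integrable (fun p : (Fin d → ℝ) × ℝ => f ((p.2 * cos b, p.2 * sin b), p.1)) := by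
  refine Continuous.integrable_of_hasCompactSupport
    (hf.continuous.comp (by fun_prop)) ?_
  refine hf.compact.comp_leftInverse
    (g := fun p : (Fin d → ℝ) × ℝ => ((p.2 * cos b, p.2 * sin b), p.1))
    (k := fun x => (x.2, x.1.1 * cos b + x.1.2 * sin b)) ?_ (by fun_prop) (by fun_prop)
  rintro ⟨z, r⟩
  exact Prod.ext rfl (leftInverse_ray b r)

lemma hasCompactSupport_ray (hf : HasCompactSupport f) (b : ℝ) (z : Fin d → ℝ) :
    HasCompactSupport (fun r : ℝ => f ((r * cos b, r * sin b), z)) :=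
  hf.comp_leftInverse (g := fun r : ℝ => ((r * cos b, r * sin b), z))
    (k := fun x => x.1.1 * cos b + x.1.2 * sin b) (leftInverse_ray b) (by fun_prop) (by fun_prop)

lemma IsTest.integrable_ray (hf : IsTest f) (b : ℝ) (z : Fin d → ℝ) :
    Integrable (fun r : ℝ => f ((r * cos b, r * sin b), z)) :=
  (hf.continuous.comp (by fun_prop)).integrable_of_hasCompactSupport
    (hasCompactSupport_ray hf.compact b z)

lemma IsTest.integrable_integral_ray (hf : IsTest f) (b : ℝ) :
    Integrable (fun z : Fin d → ℝ => ∫ r in Ioi (0 : ℝ), f ((r * cos b, r * sin b), z)) := by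
  have h := (hf.integrable_comp_ray b).integrableOn (s := univ ×ˢ Ioi (0 : ℝ))
  rw [IntegrableOn, Measure.volume_eq_prod, ← Measure.prod_restrict, Measure.restrict_univ] at h
  exact h.integral_prod_left

lemma faceInt_add (hf : IsTest f) (hg : IsTest g) (b : ℝ) :
    faceInt d b (fun x => f x + g x) = faceInt d b f + faceInt d b g := by
  simp only [faceInt]
  rw [← integral_add (hf.integrable_integral_ray b) (hg.integrable_integral_ray b)]
  congr 1
  funext z
  exact integral_add (hf.integrable_ray b z).integrableOn (hg.integrable_ray b z).integrableOn

lemma faceInt_neg (b : ℝ) : faceInt d b (fun x => -f x) = -faceInt d b f := by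
  simp only [faceInt, integral_neg]

lemma faceInt_sub (hf : IsTest f) (hg : IsTest g) (b : ℝ) :
    faceInt d b (fun x => f x - g x) = faceInt d b f - faceInt d b g := by
  simp only [sub_eq_add_neg]
  rw [faceInt_add hf hg.neg, faceInt_neg]

lemma faceInt_const_mul (c : ℂ) (b : ℝ) :
    faceInt d b (fun x => c * f x) = c * faceInt d b f := by
  simp only [faceInt, integral_const_mul]

lemma faceInt_congr {b : ℝ} (h : ∀ r : ℝ, 0 < r → ∀ z, f ((r * cos b, r * sin b), z) =
    g ((r * cos b, r * sin b), z)) : faceInt d b f = faceInt d b g := by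
  simp only [faceInt]
  congr 1
  funext z
  exact setIntegral_congr_fun measurableSet_Ioi fun r hr => h r hr z

lemma IsTest.slice_fst (hf : IsTest f) (z : Fin d → ℝ) :
    HasCompactSupport (fun y => f (y, z)) :=
  hf.compact.comp_leftInverse (g := fun y => (y, z)) (k := Prod.fst) (fun _ => rfl)
    (by fun_prop) (by fun_prop)

lemma IsTest.slice_snd (hf : IsTest f) (y : ℝ × ℝ) :
    HasCompactSupport (fun z => f (y, z)) :=
  hf.compact.comp_leftInverse (g := fun z => (y, z)) (k := Prod.snd) (fun _ => rfl)
    (by fun_prop) (by fun_prop)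

lemma fderiv_slice_fst (hf : IsTest f) (y v : ℝ × ℝ) (z : Fin d → ℝ) :
    fderiv ℝ (fun y => f (y, z)) y v = dd3 d f (v, 0) (y, z) := by
  have h := (hf.differentiable (y, z)).hasFDerivAt.comp y (hasFDerivAt_prodMk_left (𝕜 := ℝ) y z)
  have h2 : fderiv ℝ (fun y => f (y, z)) y = _ := h.fderiv
  rw [h2]
  simp [dd3]

lemma fderiv_slice_snd (hf : IsTest f) (y : ℝ × ℝ) (z w : Fin d → ℝ) :
    fderiv ℝ (fun z => f (y, z)) z w = dd3 d f (0, w) (y, z) := by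
  have h := (hf.differentiable (y, z)).hasFDerivAt.comp z (hasFDerivAt_prodMk_right y z)
  have h2 : fderiv ℝ (fun z => f (y, z)) z = _ := h.fderiv
  rw [h2]
  simp [dd3]

lemma integral_dihedral_dd3_snd (hf : IsTest f) (a b : ℝ) (w : Fin d → ℝ) :
    ∫ x in dihedral d a b, dd3 d f (0, w) x = 0 := by
  have hi := (hf.dd3 (0, w)).integrable.integrableOn (s := dihedral d a b)
  rw [dihedral, Measure.volume_eq_prod] at hi ⊢
  rw [setIntegral_prod _ hi]
  have hz : ∀ y : ℝ × ℝ, ∫ z in (univ : Set (Fin d → ℝ)), dd3 d f (0, w) (y, z) = 0 := by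
    intro y
    rw [Measure.restrict_univ]
    simp_rw [← fderiv_slice_snd hf]
    have hs : ContDiff ℝ (⊤ : ℕ∞) (fun z => f (y, z)) := hf.smooth.comp (by fun_prop)
    have hc := hf.slice_snd y
    have h1 : Integrable (fun z => f (y, z)) :=
      hs.continuous.integrable_of_hasCompactSupport hc
    have h2 : Integrable (fun z => fderiv ℝ (fun z => f (y, z)) z w) :=
      ((hs.continuous_fderiv (by simp)).clm_apply
        continuous_const).integrable_of_hasCompactSupport (hc.fderiv_apply ℝ w)
    have := integral_mul_fderiv_eq_neg_fderiv_mul_of_integrable (μ := volume) (v := w)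
      (f := fun _ : Fin d → ℝ => (1 : ℂ)) (g := fun z => f (y, z)) (by simp) (by simpa using h2)
      (by simpa using h1) (fun _ _ => differentiableAt_const _)
      (fun x _ => hs.differentiable (by simp) x)
    simpa using this
  simp only [hz, integral_zero]

lemma integral_dihedral_dd3_fst {p q : (ℝ × ℝ) × (Fin d → ℝ) → ℂ} (hp : IsTest p)
    (hq : IsTest q) {a b : ℝ} (hab : a ≤ b) (hba : b ≤ a + 2 * π) :
    ∫ x in dihedral d a b, (dd3 d p ((1, 0), 0) x + dd3 d q ((0, 1), 0) x) =
      faceInt d b (fun x => -sin b * p x + cos b * q x) -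
      faceInt d a (fun x => -sin a * p x + cos a * q x) := by
  have hi := ((hp.dd3 ((1, 0), 0)).add (hq.dd3 ((0, 1), 0))).integrable.integrableOn
    (s := dihedral d a b)
  have ht : ∀ c : ℝ, IsTest (fun x => -sin c * p x + cos c * q x) := fun c =>
    (hp.const_mul _).add (hq.const_mul _)
  rw [IntegrableOn, dihedral, Measure.volume_eq_prod, ← Measure.prod_restrict,
    Measure.restrict_univ] at hi
  rw [dihedral, Measure.volume_eq_prod, ← Measure.prod_restrict,
    Measure.restrict_univ, integral_prod_symm _ hi]
  simp only [faceInt]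
  rw [← integral_sub ((ht b).integrable_integral_ray b) ((ht a).integrable_integral_ray a)]
  congr 1
  funext z
  simp_rw [← fderiv_slice_fst hp, ← fderiv_slice_fst hq]
  exact integral_sector_divergence hab hba
    ((hp.smooth.of_le (by exact_mod_cast le_top)).comp (by fun_prop))
    ((hq.smooth.of_le (by exact_mod_cast le_top)).comp (by fun_prop))
    (hp.slice_fst z) (hq.slice_fst z)

lemma dd3_mul (hf : IsTest f) (hg : IsTest g) (v x : (ℝ × ℝ) × (Fin d → ℝ)) :
    dd3 d (fun x => f x * g x) v x = f x * dd3 d g v x + dd3 d f v x * g x := by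
  simp only [dd3]
  rw [fderiv_fun_mul (hf.differentiable x) (hg.differentiable x)]
  simp [mul_comm]

lemma dd3_sub (hf : IsTest f) (hg : IsTest g) (v x : (ℝ × ℝ) × (Fin d → ℝ)) :
    dd3 d (fun x => f x - g x) v x = dd3 d f v x - dd3 d g v x := by
  simp only [dd3]
  rw [fderiv_fun_sub (hf.differentiable x) (hg.differentiable x)]
  simp

/-- Second Green identity in a dihedral angle for compactly supported functions. -/
lemma green_dihedral (hf : IsTest f) (hg : IsTest g) {a b : ℝ} (hab : a ≤ b)
    (hba : b ≤ a + 2 * π) :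
    (∫ x in dihedral d a b, -lap3 d f x * g x) - ∫ x in dihedral d a b, f x * -lap3 d g x =
      (faceInt d a (fun x => dd3 d f ((-sin a, cos a), 0) x * g x) -
        faceInt d a (fun x => f x * dd3 d g ((-sin a, cos a), 0) x)) -
      (faceInt d b (fun x => dd3 d f ((-sin b, cos b), 0) x * g x) -
        faceInt d b (fun x => f x * dd3 d g ((-sin b, cos b), 0) x)) := by
  set F : (ℝ × ℝ) × (Fin d → ℝ) → (ℝ × ℝ) × (Fin d → ℝ) → ℂ :=
    fun v x => dd3 d f v x * g x - f x * dd3 d g v x with hF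
  have hFt : ∀ v, IsTest (F v) := fun v => ((hf.dd3 v).mul hg).sub (hf.mul (hg.dd3 v))
  have hFd : ∀ v x, dd3 d (F v) v x =
      dd3 d (dd3 d f v) v x * g x - f x * dd3 d (dd3 d g v) v x := by
    intro v x
    rw [dd3_sub ((hf.dd3 v).mul hg) (hf.mul (hg.dd3 v)), dd3_mul (hf.dd3 v) hg,
      dd3_mul hf (hg.dd3 v)]
    ring
  have hface : ∀ c : ℝ, faceInt d c (fun x => dd3 d f ((-sin c, cos c), 0) x * g x) -
        faceInt d c (fun x => f x * dd3 d g ((-sin c, cos c), 0) x) =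
      faceInt d c (fun x => -sin c * F ((1, 0), 0) x + cos c * F ((0, 1), 0) x) := by
    intro c
    rw [← faceInt_sub ((hf.dd3 _).mul hg) (hf.mul (hg.dd3 _))]
    congr 1
    funext x
    simp only [hF]
    rw [dd3_fst_eq (f := f) (-sin c), dd3_fst_eq (f := g) (-sin c)]
    push_cast
    ring
  have hdiv : ∀ x, -lap3 d f x * g x - f x * -lap3 d g x =
      -((dd3 d (F ((1, 0), 0)) ((1, 0), 0) x + dd3 d (F ((0, 1), 0)) ((0, 1), 0) x) +
        ∑ i, dd3 d (F (0, Pi.single i 1)) (0, Pi.single i 1) x) := by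
    intro x
    simp only [hFd, lap3, Finset.sum_sub_distrib, ← Finset.sum_mul, ← Finset.mul_sum]
    ring
  rw [← integral_sub (hf.lap3.neg.mul hg).integrable.integrableOn
    (hf.mul hg.lap3.neg).integrable.integrableOn]
  simp_rw [hdiv]
  rw [integral_neg, integral_add
    (((hFt _).dd3 _).add ((hFt _).dd3 _)).integrable.integrableOn
    (IsTest.sum _ fun i => (hFt _).dd3 _).integrable.integrableOn,
    integral_finsetSum _ fun i _ => ((hFt _).dd3 _).integrable.integrableOn]
  simp only [integral_dihedral_dd3_snd (hFt _)]
  rw [integral_dihedral_dd3_fst (hFt _) (hFt _) hab hba, hface, hface]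
  simp

lemma rotDilY_ray (χ ψ b r : ℝ) (z : Fin d → ℝ) :
    rotDilY d χ ψ ((r * cos b, r * sin b), z) =
      ((χ * r * cos (b + ψ), χ * r * sin (b + ψ)), z) := by
  simp only [rotDilY, cos_add, sin_add]
  ext <;> simp <;> ring

lemma contDiff_rotDilY (χ ψ : ℝ) : ContDiff ℝ (⊤ : ℕ∞) (rotDilY d χ ψ) := by
  unfold rotDilY
  fun_prop

lemma hasDerivAt_ray (hf : IsTest f) (c b r : ℝ) (z : Fin d → ℝ) :
    HasDerivAt (fun r : ℝ => f ((c * r * cos b, c * r * sin b), z))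
      (c * dd3 d f ((cos b, sin b), 0) ((c * r * cos b, c * r * sin b), z)) r := by
  have h := (hf.differentiable ((c * r * cos b, c * r * sin b), z)).hasFDerivAt.comp_hasDerivAt r
    (((((hasDerivAt_id r).const_mul c).mul_const (cos b)).prodMk
      (((hasDerivAt_id r).const_mul c).mul_const (sin b))).prodMk (hasDerivAt_const r z))
  convert! h using 1
  have : (((c * 1 * cos b, c * 1 * sin b), 0) : (ℝ × ℝ) × (Fin d → ℝ)) =
      c • ((cos b, sin b), 0) := by
    ext <;> simp
  rw [this, map_smul, Complex.real_smul, dd3]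

lemma faceInt_rotDilY (hf : IsTest f) (hg : IsTest g) (hf0 : ∀ z, f (0, z) = 0) {χ : ℝ}
    (hχ : 0 < χ) (a b : ℝ) :
    faceInt d a (fun x => dd3 d f ((cos b, sin b), 0) (rotDilY d χ (b - a) x) * g x) =
      -(((1 / χ : ℝ) ^ 2 : ℝ) : ℂ) * faceInt d b (fun x =>
        f x * dd3 d g ((cos a, sin a), 0) (rotDilY d (1 / χ) (-(b - a)) x)) := by
  have hχ' : (χ : ℂ) ≠ 0 := by exact_mod_cast hχ.ne'
  simp only [faceInt, ← integral_const_mul]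
  congr 1
  funext z
  simp only [rotDilY_ray, add_sub_cancel, show b + -(b - a) = a by ring]
  rw [integral_const_mul]
  set f' := dd3 d f ((cos b, sin b), 0) with hf'
  set g' := dd3 d g ((cos a, sin a), 0) with hg'
  have hft : IsTest f' := hf.dd3 _
  have hgt : IsTest g' := hg.dd3 _
  have hfc := hf.continuous
  have hgc := hg.continuous
  have hfc' := hft.continuous
  have hgc' := hgt.continuous
  have hcg : HasCompactSupport (fun r : ℝ => g ((r * cos a, r * sin a), z)) :=
    hasCompactSupport_ray hg.compact a z
  have hcg' : HasCompactSupport (fun r : ℝ => g' ((r * cos a, r * sin a), z)) :=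
    hasCompactSupport_ray hgt.compact a z
  have hd : ∀ r : ℝ, HasDerivAt (fun r : ℝ => f ((χ * r * cos b, χ * r * sin b), z) *
      g ((r * cos a, r * sin a), z))
      (χ * (f' ((χ * r * cos b, χ * r * sin b), z) * g ((r * cos a, r * sin a), z)) +
        f ((χ * r * cos b, χ * r * sin b), z) * g' ((r * cos a, r * sin a), z)) r := by
    intro r
    have h := (hasDerivAt_ray hf χ b r z).mul (hasDerivAt_ray hg 1 a r z)
    simp only [one_mul, Complex.ofReal_one] at h
    convert! h using 1
    ring
  have hi1 : Integrable (fun r : ℝ => f' ((χ * r * cos b, χ * r * sin b), z) *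
      g ((r * cos a, r * sin a), z)) :=
    Continuous.integrable_of_hasCompactSupport (by fun_prop) hcg.mul_left
  have hi2 : Integrable (fun r : ℝ => f ((χ * r * cos b, χ * r * sin b), z) *
      g' ((r * cos a, r * sin a), z)) :=
    Continuous.integrable_of_hasCompactSupport (by fun_prop) hcg'.mul_left
  have h0 : χ * (∫ r in Ioi (0 : ℝ), f' ((χ * r * cos b, χ * r * sin b), z) *
        g ((r * cos a, r * sin a), z)) +
      ∫ r in Ioi (0 : ℝ), f ((χ * r * cos b, χ * r * sin b), z) *
        g' ((r * cos a, r * sin a), z) = 0 := by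
    have hD := funext fun r => (hd r).deriv
    have hs := contDiff_one_iff_deriv.2 ⟨fun r => (hd r).differentiableAt, by
      rw [hD]
      fun_prop⟩
    have := hcg.mul_left (f := fun r : ℝ => f ((χ * r * cos b, χ * r * sin b), z))
    have h3 := HasCompactSupport.integral_Ioi_deriv_eq hs this 0
    rw [hD] at h3
    rw [integral_add (hi1.const_mul _).integrableOn hi2.integrableOn, integral_const_mul] at h3
    rw [h3]
    simp only [mul_zero, zero_mul]
    rw [show (((0, 0) : ℝ × ℝ), z) = (0, z) from rfl, hf0]
    simp
  have h1 := integral_comp_mul_left_Ioi (fun s => f ((s * cos b, s * sin b), z) *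
    g' ((1 / χ * s * cos a, 1 / χ * s * sin a), z)) 0 hχ
  have h2 : ∀ r : ℝ, 1 / χ * (χ * r) = r := fun r => by field_simp
  simp only [h2, mul_zero] at h1
  rw [h1, Complex.real_smul] at h0
  push_cast at h0 ⊢
  linear_combination (1 / χ : ℂ) * h0 + (-(∫ r in Ioi (0 : ℝ),
    f' ((χ * r * cos b, χ * r * sin b), z) * g ((r * cos a, r * sin a), z)) + 0) *
      (mul_inv_cancel₀ hχ')

lemma ray_mem_closure_dihedral {a b c r : ℝ} (hab : a < b) (hac : a ≤ c) (hcb : c ≤ b)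
    (hr : 0 < r) (z : Fin d → ℝ) :
    ((r * cos c, r * sin c), z) ∈ closure (dihedral d a b) := by
  have h : c ∈ closure (Ioo a b) := by
    rw [closure_Ioo hab.ne]
    exact ⟨hac, hcb⟩
  exact map_mem_closure (f := fun θ : ℝ => (((r * cos θ, r * sin θ), z) :
    (ℝ × ℝ) × (Fin d → ℝ))) (by fun_prop) h
    fun θ hθ => ⟨⟨r, θ, hr, hθ.1, hθ.2, rfl⟩, trivial⟩

lemma dihedral_mono {a b a' b' : ℝ} (ha : a' ≤ a) (hb : b ≤ b') :
    dihedral d a b ⊆ dihedral d a' b' := by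
  rintro x ⟨⟨r, θ, hr, h1, h2, h⟩, -⟩
  exact ⟨⟨r, θ, hr, by linarith, by linarith, h⟩, trivial⟩

lemma measurableSet_dihedral {a b : ℝ} (hba : b ≤ a + 2 * π) :
    MeasurableSet (dihedral d a b) :=
  (measurableSet_sector hba).prod MeasurableSet.univ

lemma rotDilY_neg_rotDilY {χ : ℝ} (hχ : χ ≠ 0) (ψ : ℝ) (x : (ℝ × ℝ) × (Fin d → ℝ)) :
    rotDilY d χ ψ (rotDilY d (1 / χ) (-ψ) x) = x := by
  have h := sin_sq_add_cos_sq ψ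
  simp only [rotDilY, cos_neg, sin_neg]
  refine Prod.ext (Prod.ext ?_ ?_) rfl
  · field_simp
    linear_combination x.1.1 * h
  · field_simp
    linear_combination x.1.2 * h

lemma SmoothNear3.exists_isTest {S T : Set ((ℝ × ℝ) × (Fin d → ℝ))}
    (hf : SmoothNear3 d f (closure S \ edge d)) (hT : IsCompact T) (hTe : Disjoint T (edge d)) :
    ∃ g, IsTest g ∧ (∀ x ∈ closure S, x ∈ T → g =ᶠ[nhds x] f) ∧ ∀ x, f x = 0 → g x = 0 := by
  obtain ⟨O, hO, hSO, hfO⟩ := hf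
  obtain ⟨g, hg, h1, h2⟩ := exists_isTest_eventuallyEq hO (hT.inter_right isClosed_closure)
    (fun x hx => hSO ⟨hx.2, disjoint_left.1 hTe hx.1⟩) hfO
  exact ⟨g, hg, fun x hx hxT => h1 x ⟨hxT, hx⟩, h2⟩

lemma dd3_eq_zero {x : (ℝ × ℝ) × (Fin d → ℝ)} (h : f =ᶠ[nhds x] 0)
    (v : (ℝ × ℝ) × (Fin d → ℝ)) : dd3 d f v x = 0 := by
  simp [dd3, h.fderiv_eq]

lemma dd3_neg_fst (a b : ℝ) (x : (ℝ × ℝ) × (Fin d → ℝ)) :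
    dd3 d f ((a, -b), 0) x = -dd3 d f ((-a, b), 0) x := by
  rw [dd3, dd3, ← map_neg]
  simp

lemma lap3_eq_zero {x : (ℝ × ℝ) × (Fin d → ℝ)} (h : f =ᶠ[nhds x] 0) : lap3 d f x = 0 := by
  have h0 : ∀ v, dd3 d (0 : (ℝ × ℝ) × (Fin d → ℝ) → ℂ) v = 0 := fun v => by
    funext y
    simp [dd3]
  rw [lap3_congr h]
  simp [lap3, h0]

lemma mul_conj_congr {u v : (ℝ × ℝ) × (Fin d → ℝ) → ℂ} {x : (ℝ × ℝ) × (Fin d → ℝ)}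
    (hv : IsTest v) (hu : u =ᶠ[nhds x] f) (h : v =ᶠ[nhds x] g ∨ f =ᶠ[nhds x] 0) :
    -lap3 d f x * conj (g x) = -lap3 d u x * conj (v x) ∧
    f x * conj (-lap3 d g x) = u x * -lap3 d (fun x => conj (v x)) x ∧
    (∀ e, dd3 d f e x * conj (g x) = dd3 d u e x * conj (v x)) ∧
    ∀ e, f x * conj (dd3 d g e x) = u x * dd3 d (fun x => conj (v x)) e x := by
  rw [lap3_conj hv]
  simp only [dd3_conj hv, lap3_congr hu, hu.eq_of_nhds, (dd3_congr _ hu).eq_of_nhds]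
  rcases h with h | h
  · simp only [lap3_congr h, h.eq_of_nhds, (dd3_congr _ h).eq_of_nhds, map_neg, and_self,
      implies_true]
  · simp [lap3_eq_zero h, h.eq_of_nhds, dd3_eq_zero h]

end Test

/-- Nonlocal Green formula for `-Δ` in the dihedral angle `Ω = K × ℝ^d` with the nonlocal
Neumann-type boundary operator `∂U/∂n₁|_{Γ₁} + α (∂U/∂r)(χ₁₂ r, φ + φ₁₂, z)|_{Γ₁}`. -/
theorem green_formula_nonlocal_neumann_dihedral
    (b₁ b₂ b₃ : ℝ) (hb₀ : 0 < b₁) (hb₁₂ : b₁ < b₂) (hb₂₃ : b₂ < b₃) (hb₃ : b₃ < 2 * π)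
    (hd : 1 ≤ d) (α χ₁₂ : ℝ) (hχ : 0 < χ₁₂)
    (U V₁ V₂ : (ℝ × ℝ) × (Fin d → ℝ) → ℂ)
    (hU : SmoothNear3 d U (closure (dihedral d b₁ b₃) \ edge d))
    (hUc : HasCompactSupport U) (hU0 : Disjoint (tsupport U) (edge d))
    (hV₁ : SmoothNear3 d V₁ (closure (dihedral d b₁ b₂) \ edge d))
    (hV₂ : SmoothNear3 d V₂ (closure (dihedral d b₂ b₃) \ edge d)) :
    ((∫ x in dihedral d b₁ b₂, (-(lap3 d U x)) * conj (V₁ x)) +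
      (∫ x in dihedral d b₂ b₃, (-(lap3 d U x)) * conj (V₂ x))) +
    faceInt d b₁ (fun x => (dd3 d U ((-Real.sin b₁, Real.cos b₁), 0) x +
        (α : ℂ) * dd3 d U ((Real.cos b₂, Real.sin b₂), 0) (rotDilY d χ₁₂ (b₂ - b₁) x)) *
      conj (-(V₁ x))) +
    faceInt d b₃ (fun x => dd3 d U ((Real.sin b₃, -Real.cos b₃), 0) x * conj (-(V₂ x))) +
    faceInt d b₂ (fun x => dd3 d U ((-Real.sin b₂, Real.cos b₂), 0) x *
      (conj (V₁ x) - conj (V₂ x))) =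
    ((∫ x in dihedral d b₁ b₂, U x * conj (-(lap3 d V₁ x))) +
      (∫ x in dihedral d b₂ b₃, U x * conj (-(lap3 d V₂ x)))) +
    faceInt d b₁ (fun x => (-(U x)) * conj (dd3 d V₁ ((-Real.sin b₁, Real.cos b₁), 0) x)) +
    faceInt d b₃ (fun x => (-(U x)) * conj (dd3 d V₂ ((Real.sin b₃, -Real.cos b₃), 0) x)) +
    faceInt d b₂ (fun x => U x * conj (dd3 d V₁ ((-Real.sin b₂, Real.cos b₂), 0) x -
      dd3 d V₂ ((-Real.sin b₂, Real.cos b₂), 0) x +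
      (α : ℂ) * (((1 / χ₁₂ : ℝ) ^ 2 : ℝ) : ℂ) *
        dd3 d V₁ ((Real.cos b₁, Real.sin b₁), 0) (rotDilY d (1 / χ₁₂) (-(b₂ - b₁)) x))) := by
  set T := tsupport U with hT
  have hTc : IsCompact T := hUc
  set R := rotDilY d χ₁₂ (b₂ - b₁) with hR
  set R' := rotDilY d (1 / χ₁₂) (-(b₂ - b₁)) with hR'
  have hRR' : ∀ x, R (R' x) = x := rotDilY_neg_rotDilY hχ.ne' _
  have hR'R : ∀ x, R' (R x) = x := by
    have := rotDilY_neg_rotDilY (d := d) (χ := 1 / χ₁₂) (by positivity) (-(b₂ - b₁))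
    simpa only [one_div_one_div, neg_neg] using this
  have hRedge : ∀ x ∈ edge d, R x ∈ edge d := by
    rintro x ⟨hx, -⟩
    refine ⟨?_, trivial⟩
    rw [mem_singleton_iff] at hx ⊢
    simp [hR, rotDilY, hx]
  have hT₁c : IsCompact (T ∪ R' '' T) :=
    hTc.union (hTc.image (contDiff_rotDilY _ _).continuous)
  have hT₁e : Disjoint (T ∪ R' '' T) (edge d) := by
    rw [disjoint_union_left]
    refine ⟨hU0, disjoint_left.2 ?_⟩
    rintro _ ⟨x, hx, rfl⟩ he
    exact disjoint_left.1 hU0 hx (hRR' x ▸ hRedge _ he)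
  obtain ⟨u, hu, huU, hu0⟩ := hU.exists_isTest hTc hU0
  obtain ⟨v₁, hv₁, hvV₁, -⟩ := hV₁.exists_isTest hT₁c hT₁e
  obtain ⟨v₂, hv₂, hvV₂, -⟩ := hV₂.exists_isTest hTc hU0
  have hUT : ∀ x ∉ T, U =ᶠ[nhds x] 0 := fun x hx => notMem_tsupport_iff_eventuallyEq.1 hx
  have huU' : ∀ x ∈ closure (dihedral d b₁ b₃), u =ᶠ[nhds x] U := by
    intro x hx
    by_cases hxT : x ∈ T
    · exact huU x hx hxT
    · filter_upwards [hUT x hxT] with y hy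
      rw [hy, hu0 y hy]
      rfl
  have hedge : ∀ z, u (0, z) = 0 := fun z => hu0 _ <| image_eq_zero_of_notMem_tsupport
    fun h => disjoint_left.1 hU0 h ⟨rfl, trivial⟩
  have hs₁ : closure (dihedral d b₁ b₂) ⊆ closure (dihedral d b₁ b₃) :=
    closure_mono (dihedral_mono le_rfl hb₂₃.le)
  have hs₂ : closure (dihedral d b₂ b₃) ⊆ closure (dihedral d b₁ b₃) :=
    closure_mono (dihedral_mono hb₁₂.le le_rfl)
  have key₁ := fun x (hx : x ∈ closure (dihedral d b₁ b₂)) =>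
    mul_conj_congr (g := V₁) hv₁ (huU' x (hs₁ hx)) <| by
      by_cases hxT : x ∈ T
      · exact Or.inl (hvV₁ x hx (Or.inl hxT))
      · exact Or.inr (hUT x hxT)
  have key₂ := fun x (hx : x ∈ closure (dihedral d b₂ b₃)) =>
    mul_conj_congr (g := V₂) hv₂ (huU' x (hs₂ hx)) <| by
      by_cases hxT : x ∈ T
      · exact Or.inl (hvV₂ x hx hxT)
      · exact Or.inr (hUT x hxT)
  have keyR : ∀ x ∈ closure (dihedral d b₁ b₂), R x ∈ closure (dihedral d b₁ b₃) → ∀ e,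
      dd3 d U e (R x) * conj (V₁ x) = dd3 d u e (R x) * conj (v₁ x) := by
    intro x hx hRx e
    rw [← (dd3_congr e (huU' _ hRx)).eq_of_nhds]
    by_cases hxT : R x ∈ T
    · rw [(hvV₁ x hx (Or.inr ⟨_, hxT, hR'R x⟩)).eq_of_nhds]
    · rw [dd3_eq_zero ((huU' _ hRx).trans (hUT _ hxT)), zero_mul, zero_mul]
  set w₁ := fun x => conj (v₁ x) with hw₁
  set w₂ := fun x => conj (v₂ x) with hw₂
  have tw₁ : IsTest w₁ := hv₁.star
  have tw₂ : IsTest w₂ := hv₂.star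
  have keyR' : ∀ x ∈ closure (dihedral d b₁ b₃), R' x ∈ closure (dihedral d b₁ b₂) → ∀ e,
      U x * conj (dd3 d V₁ e (R' x)) = u x * dd3 d w₁ e (R' x) := by
    intro x hx hRx e
    rw [← (huU' _ hx).eq_of_nhds, hw₁, dd3_conj hv₁]
    beta_reduce
    by_cases hxT : x ∈ T
    · rw [(dd3_congr e (hvV₁ _ hRx (Or.inr ⟨_, hxT, rfl⟩))).eq_of_nhds]
    · rw [((huU' _ hx).trans (hUT _ hxT)).eq_of_nhds]
      simp
  have hm₁ : MeasurableSet (dihedral d b₁ b₂) := measurableSet_dihedral (by linarith)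
  have hm₂ : MeasurableSet (dihedral d b₂ b₃) := measurableSet_dihedral (by linarith)
  have tR : ContDiff ℝ (⊤ : ℕ∞) R := contDiff_rotDilY _ _
  have tR' : ContDiff ℝ (⊤ : ℕ∞) R' := contDiff_rotDilY _ _
  have tuR : ∀ e, IsTest (fun x => dd3 d u e (R x) * w₁ x) := fun e =>
    tw₁.mul_left ((hu.dd3 e).smooth.comp tR)
  have twR : ∀ e, IsTest (fun x => u x * dd3 d w₁ e (R' x)) := fun e =>
    hu.mul_right ((tw₁.dd3 e).smooth.comp tR')
  have i₁ : ∫ x in dihedral d b₁ b₂, (-(lap3 d U x)) * conj (V₁ x) =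
      ∫ x in dihedral d b₁ b₂, -lap3 d u x * w₁ x :=
    setIntegral_congr_fun hm₁ fun x hx => (key₁ x (subset_closure hx)).1
  have i₂ : ∫ x in dihedral d b₂ b₃, (-(lap3 d U x)) * conj (V₂ x) =
      ∫ x in dihedral d b₂ b₃, -lap3 d u x * w₂ x :=
    setIntegral_congr_fun hm₂ fun x hx => (key₂ x (subset_closure hx)).1
  have j₁ : ∫ x in dihedral d b₁ b₂, U x * conj (-(lap3 d V₁ x)) =
      ∫ x in dihedral d b₁ b₂, u x * -lap3 d w₁ x :=
    setIntegral_congr_fun hm₁ fun x hx => (key₁ x (subset_closure hx)).2.1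
  have j₂ : ∫ x in dihedral d b₂ b₃, U x * conj (-(lap3 d V₂ x)) =
      ∫ x in dihedral d b₂ b₃, u x * -lap3 d w₂ x :=
    setIntegral_congr_fun hm₂ fun x hx => (key₂ x (subset_closure hx)).2.1
  have f₁ : faceInt d b₁ (fun x => (dd3 d U ((-Real.sin b₁, Real.cos b₁), 0) x +
        (α : ℂ) * dd3 d U ((Real.cos b₂, Real.sin b₂), 0) (R x)) * conj (-(V₁ x))) =
      -faceInt d b₁ (fun x => dd3 d u ((-sin b₁, cos b₁), 0) x * w₁ x) -
        α * faceInt d b₁ (fun x => dd3 d u ((cos b₂, sin b₂), 0) (R x) * w₁ x) := by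
    rw [← faceInt_neg, ← faceInt_const_mul, ← faceInt_sub ((hu.dd3 _).mul tw₁).neg
      ((tuR _).const_mul _)]
    refine faceInt_congr fun r hr z => ?_
    have hx := ray_mem_closure_dihedral hb₁₂ le_rfl hb₁₂.le hr z
    have hRx : R ((r * cos b₁, r * sin b₁), z) ∈ closure (dihedral d b₁ b₃) := by
      rw [hR, rotDilY_ray, add_sub_cancel]
      exact ray_mem_closure_dihedral (hb₁₂.trans hb₂₃) hb₁₂.le hb₂₃.le (mul_pos hχ hr) z
    rw [map_neg]
    linear_combination (-1 : ℂ) * (key₁ _ hx).2.2.1 ((-sin b₁, cos b₁), 0) -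
      α * keyR _ hx hRx ((cos b₂, sin b₂), 0)
  have f₃ : faceInt d b₃ (fun x => dd3 d U ((Real.sin b₃, -Real.cos b₃), 0) x *
        conj (-(V₂ x))) = faceInt d b₃ (fun x => dd3 d u ((-sin b₃, cos b₃), 0) x * w₂ x) := by
    refine faceInt_congr fun r hr z => ?_
    have hx := ray_mem_closure_dihedral hb₂₃ hb₂₃.le le_rfl hr z
    rw [← (key₂ _ hx).2.2.1 ((-sin b₃, cos b₃), 0), dd3_neg_fst, map_neg, neg_mul_neg]
  have f₂ : faceInt d b₂ (fun x => dd3 d U ((-Real.sin b₂, Real.cos b₂), 0) x *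
        (conj (V₁ x) - conj (V₂ x))) =
      faceInt d b₂ (fun x => dd3 d u ((-sin b₂, cos b₂), 0) x * w₁ x) -
        faceInt d b₂ (fun x => dd3 d u ((-sin b₂, cos b₂), 0) x * w₂ x) := by
    rw [← faceInt_sub ((hu.dd3 _).mul tw₁) ((hu.dd3 _).mul tw₂)]
    refine faceInt_congr fun r hr z => ?_
    have hx₁ := ray_mem_closure_dihedral hb₁₂ hb₁₂.le le_rfl hr z
    have hx₂ := ray_mem_closure_dihedral hb₂₃ le_rfl hb₂₃.le hr z
    linear_combination (key₁ _ hx₁).2.2.1 ((-sin b₂, cos b₂), 0) -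
      (key₂ _ hx₂).2.2.1 ((-sin b₂, cos b₂), 0)
  have g₁ : faceInt d b₁ (fun x => (-(U x)) *
        conj (dd3 d V₁ ((-Real.sin b₁, Real.cos b₁), 0) x)) =
      -faceInt d b₁ (fun x => u x * dd3 d w₁ ((-sin b₁, cos b₁), 0) x) := by
    rw [← faceInt_neg]
    refine faceInt_congr fun r hr z => ?_
    have hx := ray_mem_closure_dihedral hb₁₂ le_rfl hb₁₂.le hr z
    linear_combination (-1 : ℂ) * (key₁ _ hx).2.2.2 ((-sin b₁, cos b₁), 0)
  have g₃ : faceInt d b₃ (fun x => (-(U x)) *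
        conj (dd3 d V₂ ((Real.sin b₃, -Real.cos b₃), 0) x)) =
      faceInt d b₃ (fun x => u x * dd3 d w₂ ((-sin b₃, cos b₃), 0) x) := by
    refine faceInt_congr fun r hr z => ?_
    have hx := ray_mem_closure_dihedral hb₂₃ hb₂₃.le le_rfl hr z
    rw [← (key₂ _ hx).2.2.2 ((-sin b₃, cos b₃), 0), dd3_neg_fst, map_neg, neg_mul_neg]
  have g₂ : faceInt d b₂ (fun x => U x * conj (dd3 d V₁ ((-Real.sin b₂, Real.cos b₂), 0) x -
        dd3 d V₂ ((-Real.sin b₂, Real.cos b₂), 0) x +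
        (α : ℂ) * (((1 / χ₁₂ : ℝ) ^ 2 : ℝ) : ℂ) *
          dd3 d V₁ ((Real.cos b₁, Real.sin b₁), 0) (R' x))) =
      faceInt d b₂ (fun x => u x * dd3 d w₁ ((-sin b₂, cos b₂), 0) x) -
        faceInt d b₂ (fun x => u x * dd3 d w₂ ((-sin b₂, cos b₂), 0) x) +
        (α * (((1 / χ₁₂ : ℝ) ^ 2 : ℝ) : ℂ)) *
          faceInt d b₂ (fun x => u x * dd3 d w₁ ((cos b₁, sin b₁), 0) (R' x)) := by
    have t₁ := hu.mul (tw₁.dd3 ((-sin b₂, cos b₂), 0))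
    have t₂ := hu.mul (tw₂.dd3 ((-sin b₂, cos b₂), 0))
    rw [← faceInt_const_mul, ← faceInt_sub t₁ t₂,
      ← faceInt_add (t₁.sub t₂) ((twR _).const_mul _)]
    refine faceInt_congr fun r hr z => ?_
    have hx₁ := ray_mem_closure_dihedral hb₁₂ hb₁₂.le le_rfl hr z
    have hx₂ := ray_mem_closure_dihedral hb₂₃ le_rfl hb₂₃.le hr z
    have hRx : R' ((r * cos b₂, r * sin b₂), z) ∈ closure (dihedral d b₁ b₂) := by
      rw [hR', rotDilY_ray, show b₂ + -(b₂ - b₁) = b₁ by ring]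
      exact ray_mem_closure_dihedral hb₁₂ le_rfl hb₁₂.le (by positivity) z
    rw [map_add, map_sub, map_mul, map_mul, Complex.conj_ofReal, Complex.conj_ofReal]
    linear_combination (key₁ _ hx₁).2.2.2 ((-sin b₂, cos b₂), 0) -
      (key₂ _ hx₂).2.2.2 ((-sin b₂, cos b₂), 0) +
      (α * (((1 / χ₁₂ : ℝ) ^ 2 : ℝ) : ℂ)) * keyR' _ (hs₁ hx₁) hRx ((cos b₁, sin b₁), 0)
  have G₁ := green_dihedral hu tw₁ hb₁₂.le (by linarith)
  have G₂ := green_dihedral hu tw₂ hb₂₃.le (by linarith)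
  have N := faceInt_rotDilY hu tw₁ hedge hχ b₁ b₂
  rw [i₁, i₂, j₁, j₂, f₁, f₂, f₃, g₁, g₂, g₃]
  linear_combination G₁ + G₂ - α * N
end
end

section
/- Let u ∈ C₀^∞(Π̄) and w_t ∈ C^∞(Π̄_t) for t = 1,2. Then the following nonlocal Green formula on the strip Π holds: Σ_{t=1,2} ∫∫_{Π_t} (−u_{φφ} − u_{ττ})·conj(w_t) dφ dτ + ∫_ℝ ( u(b₁,τ) + α·u(b₂, τ + ln χ₁₂) )·conj(w₁_φ(b₁,τ)) dτ + ∫_ℝ u(b₃,τ)·conj(−w₂_φ(b₃,τ)) dτ + ∫_ℝ u_φ(b₂,τ)·( conj(w₁(b₂,τ)) − conj(w₂(b₂,τ)) ) dτ = Σ_{t=1,2} ∫∫_{Π_t} u·conj(−w_{t,φφ} − w_{t,ττ}) dφ dτ + ∫_ℝ u_φ(b₁,τ)·conj(w₁(b₁,τ)) dτ + ∫_ℝ (−u_φ(b₃,τ))·conj(w₂(b₃,τ)) dτ + ∫_ℝ u(b₂,τ)·conj( w₁_φ(b₂,τ) − w₂_φ(b₂,τ) + α·w₁_φ(b₁, τ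 − ln χ₁₂) ) dτ. -/
open MeasureTheory Real Set ComplexConjugate

noncomputable section

/-- The strip `{(φ, τ) : a < φ < b, τ ∈ ℝ}`. -/
def strip (a b : ℝ) : Set (ℝ × ℝ) := (Set.Ioo a b) ×ˢ (Set.univ : Set ℝ)

/-- Directional derivative; `pd W (1,0)` is `W_φ`, `pd W (0,1)` is `W_τ`. -/
def pd (W : ℝ × ℝ → ℂ) (v : ℝ × ℝ) (p : ℝ × ℝ) : ℂ := fderiv ℝ W p v

/-- `W` is smooth on an open neighbourhood of the set `s`
(the formalization of `W ∈ C^∞(s)` for a non-open `s`). -/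
def SmoothNear (W : ℝ × ℝ → ℂ) (s : Set (ℝ × ℝ)) : Prop :=
  ∃ O : Set (ℝ × ℝ), IsOpen O ∧ s ⊆ O ∧ ContDiffOn ℝ (⊤ : ℕ∞) W O


lemma closure_strip {a b : ℝ} (hab : a < b) : closure (strip a b) = Icc a b ×ˢ univ := by
  rw [strip, closure_prod_eq, closure_Ioo hab.ne, closure_univ]

lemma SmoothNear.mono {W : ℝ × ℝ → ℂ} {s t : Set (ℝ × ℝ)} (h : SmoothNear W t) (hst : s ⊆ t) :
    SmoothNear W s := by
  obtain ⟨O, hO, hs, hW⟩ := h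
  exact ⟨O, hO, hst.trans hs, hW⟩

lemma SmoothNear.dirDeriv {W : ℝ × ℝ → ℂ} {s : Set (ℝ × ℝ)} (h : SmoothNear W s) (v : ℝ × ℝ) :
    SmoothNear (pd W v) s := by
  obtain ⟨O, hO, hs, hW⟩ := h
  refine ⟨O, hO, hs, ?_⟩
  exact (hW.fderiv_of_isOpen hO (m := (⊤ : ℕ∞)) (by simp)).clm_apply contDiffOn_const

lemma SmoothNear.star {W : ℝ × ℝ → ℂ} {s : Set (ℝ × ℝ)} (h : SmoothNear W s) :
    SmoothNear (fun p => conj (W p)) s := by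
  obtain ⟨O, hO, hs, hW⟩ := h
  exact ⟨O, hO, hs, Complex.conjCLE.contDiff.comp_contDiffOn hW⟩

lemma SmoothNear.continuousOn {W : ℝ × ℝ → ℂ} {s : Set (ℝ × ℝ)} (h : SmoothNear W s) :
    ContinuousOn W s := by
  obtain ⟨O, -, hs, hW⟩ := h
  exact hW.continuousOn.mono hs

lemma SmoothNear.differentiableAt {W : ℝ × ℝ → ℂ} {s : Set (ℝ × ℝ)} (h : SmoothNear W s)
    {p : ℝ × ℝ} (hp : p ∈ s) : DifferentiableAt ℝ W p := by
  obtain ⟨O, hO, hs, hW⟩ := h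
  exact (hW.differentiableOn (by simp)).differentiableAt (hO.mem_nhds (hs hp))

lemma SmoothNear.continuous_slice {W : ℝ × ℝ → ℂ} {a b c : ℝ} (hab : a < b)
    (h : SmoothNear W (closure (strip a b))) (hc : c ∈ Icc a b) :
    Continuous fun τ : ℝ => W (c, τ) := by
  rw [closure_strip hab] at h
  exact h.continuousOn.comp_continuous (by fun_prop) fun τ => ⟨hc, mem_univ _⟩

lemma pd_conj (W : ℝ × ℝ → ℂ) (v : ℝ × ℝ) :
    pd (fun p => conj (W p)) v = fun p => conj (pd W v p) := by
  funext p
  simp only [pd]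
  exact congrArg (fun L : ℝ × ℝ →L[ℝ] ℂ => L v) (fderiv_star (𝕜 := ℝ) (f := W) (x := p))

lemma tsupport_pd_subset (W : ℝ × ℝ → ℂ) (v : ℝ × ℝ) : tsupport (pd W v) ⊆ tsupport W :=
  have h : Function.support (pd W v) ⊆ Function.support (fderiv ℝ W) :=
    fun p hp h => hp (by simp [pd, h])
  (closure_mono h).trans (tsupport_fderiv_subset ℝ)

lemma HasCompactSupport.dirDeriv {W : ℝ × ℝ → ℂ} (h : HasCompactSupport W) (v : ℝ × ℝ) :
    HasCompactSupport (pd W v) :=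
  h.mono' (subset_closure.trans (tsupport_pd_subset W v))

lemma HasCompactSupport.slice {W : ℝ × ℝ → ℂ} (h : HasCompactSupport W) (c : ℝ) :
    HasCompactSupport fun τ : ℝ => W (c, τ) :=
  h.comp_isClosedEmbedding (g := fun τ : ℝ => (c, τ)) <|
    Topology.IsClosedEmbedding.of_continuous_injective_isClosedMap (by fun_prop)
      (Prod.mk_right_injective c) (isClosedMap_prodMk_left c)

/-- The integral over a strip of a function supported in `|τ| < M` is an integral over a box. -/
lemma setIntegral_strip_eq_Icc {f : ℝ × ℝ → ℂ} (a b : ℝ) {M : ℝ}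
    (hf : ∀ p : ℝ × ℝ, M ≤ |p.2| → f p = 0) :
    ∫ p in strip a b, f p = ∫ p in Icc (a, -M) (b, M), f p := by
  have h1 : ∫ p in strip a b, f p = ∫ p in Ioo a b ×ˢ Icc (-M) M, f p := by
    refine setIntegral_eq_of_subset_of_forall_sdiff_eq_zero
      (measurableSet_Ioo.prod MeasurableSet.univ) (prod_mono_right (subset_univ _)) ?_
    rintro ⟨x, y⟩ ⟨⟨hx, -⟩, hp⟩
    refine hf _ (le_of_not_gt fun h => hp ⟨hx, ?_⟩)
    exact abs_le.1 h.le
  rw [h1, ← Icc_prod_Icc]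
  exact setIntegral_congr_set (Measure.set_prod_ae_eq Ioo_ae_eq_Icc (ae_eq_refl _))

lemma integral_eq_intervalIntegral_of_zero {f : ℝ → ℂ} {M : ℝ}
    (hf : ∀ τ : ℝ, M ≤ |τ| → f τ = 0) : ∫ τ in (-M)..M, f τ = ∫ τ, f τ := by
  refine intervalIntegral.integral_eq_integral_of_support_subset fun τ hτ => ?_
  have : |τ| < M := lt_of_not_ge fun h => hτ (hf τ h)
  exact ⟨(abs_lt.1 this).1, (abs_lt.1 this).2.le⟩

lemma exists_forall_notMem_tsupport {W : ℝ × ℝ → ℂ} (h : HasCompactSupport W) :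
    ∃ M : ℝ, 0 < M ∧ ∀ p : ℝ × ℝ, M ≤ |p.2| → p ∉ tsupport W := by
  obtain ⟨R, hR, hW⟩ := h.isBounded.exists_pos_norm_lt
  refine ⟨R, hR, fun p hp hmem => ?_⟩
  have h2 : |p.2| ≤ ‖p‖ := norm_snd_le p
  linarith [hW p hmem]

/-- The second Green formula on a strip, for a compactly supported first function. -/
lemma green_formula_strip {a b : ℝ} (hab : a < b) {u v : ℝ × ℝ → ℂ}
    (hu : SmoothNear u (closure (strip a b))) (huc : HasCompactSupport u)
    (hv : SmoothNear v (closure (strip a b))) :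
    ∫ p in strip a b, (-(pd (pd u (1, 0)) (1, 0) p) - pd (pd u (0, 1)) (0, 1) p) * v p =
      (∫ p in strip a b, u p * (-(pd (pd v (1, 0)) (1, 0) p) - pd (pd v (0, 1)) (0, 1) p)) +
      (∫ τ : ℝ, u (b, τ) * pd v (1, 0) (b, τ)) - (∫ τ : ℝ, pd u (1, 0) (b, τ) * v (b, τ)) -
      (∫ τ : ℝ, u (a, τ) * pd v (1, 0) (a, τ)) + (∫ τ : ℝ, pd u (1, 0) (a, τ) * v (a, τ)) := by
  obtain ⟨M, hM, hout⟩ := exists_forall_notMem_tsupport huc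
  have hu0 : ∀ p : ℝ × ℝ, M ≤ |p.2| → u p = 0 := fun p hp =>
    image_eq_zero_of_notMem_tsupport (hout p hp)
  have hu1 : ∀ e, ∀ p : ℝ × ℝ, M ≤ |p.2| → pd u e p = 0 := fun e p hp =>
    image_eq_zero_of_notMem_tsupport fun h => hout p hp (tsupport_pd_subset u e h)
  have hu2 : ∀ e, ∀ p : ℝ × ℝ, M ≤ |p.2| → pd (pd u e) e p = 0 := fun e p hp =>
    image_eq_zero_of_notMem_tsupport fun h =>
      hout p hp (tsupport_pd_subset u e (tsupport_pd_subset _ e h))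
  have hbox : Icc (a, -M) (b, M) ⊆ closure (strip a b) := by
    rw [closure_strip hab, ← Icc_prod_Icc]
    exact prod_mono_right (subset_univ _)
  have hcont : ∀ {W : ℝ × ℝ → ℂ}, SmoothNear W (closure (strip a b)) →
      ContinuousOn W (Icc (a, -M) (b, M)) := fun h => h.continuousOn.mono hbox
  have hint : ∀ {W : ℝ × ℝ → ℂ}, ContinuousOn W (Icc (a, -M) (b, M)) →
      IntegrableOn W (Icc (a, -M) (b, M)) := fun h => h.integrableOn_compact isCompact_Icc
  have hderiv : ∀ e, ∀ p ∈ closure (strip a b),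
      HasFDerivAt (fun p => u p * pd v e p - pd u e p * v p)
        ((u p • fderiv ℝ (pd v e) p + pd v e p • fderiv ℝ u p) -
          (pd u e p • fderiv ℝ v p + v p • fderiv ℝ (pd u e) p)) p := fun e p hp =>
    ((hu.differentiableAt hp).hasFDerivAt.mul ((hv.dirDeriv e).differentiableAt hp).hasFDerivAt).sub
      (((hu.dirDeriv e).differentiableAt hp).hasFDerivAt.mul (hv.differentiableAt hp).hasFDerivAt)
  have hcF : ∀ e, ContinuousOn (fun p => u p * pd v e p - pd u e p * v p)
      (Icc (a, -M) (b, M)) := fun e =>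
    ((hcont hu).mul (hcont (hv.dirDeriv e))).sub ((hcont (hu.dirDeriv e)).mul (hcont hv))
  have hcA : ContinuousOn
      (fun p => (-(pd (pd u (1, 0)) (1, 0) p) - pd (pd u (0, 1)) (0, 1) p) * v p)
      (Icc (a, -M) (b, M)) :=
    ((hcont ((hu.dirDeriv _).dirDeriv _)).neg.sub (hcont ((hu.dirDeriv _).dirDeriv _))).mul (hcont hv)
  have hcB : ContinuousOn
      (fun p => u p * (-(pd (pd v (1, 0)) (1, 0) p) - pd (pd v (0, 1)) (0, 1) p))
      (Icc (a, -M) (b, M)) :=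
    (hcont hu).mul ((hcont ((hv.dirDeriv _).dirDeriv _)).neg.sub (hcont ((hv.dirDeriv _).dirDeriv _)))
  have hdiv : ∀ p : ℝ × ℝ,
      ((u p • fderiv ℝ (pd v (1, 0)) p + pd v (1, 0) p • fderiv ℝ u p) -
          (pd u (1, 0) p • fderiv ℝ v p + v p • fderiv ℝ (pd u (1, 0)) p)) (1, 0) +
      ((u p • fderiv ℝ (pd v (0, 1)) p + pd v (0, 1) p • fderiv ℝ u p) -
          (pd u (0, 1) p • fderiv ℝ v p + v p • fderiv ℝ (pd u (0, 1)) p)) (0, 1) =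
      (-(pd (pd u (1, 0)) (1, 0) p) - pd (pd u (0, 1)) (0, 1) p) * v p -
        u p * (-(pd (pd v (1, 0)) (1, 0) p) - pd (pd v (0, 1)) (0, 1) p) := by
    intro p
    simp [pd]
    ring
  have key := integral_divergence_prod_Icc_of_hasFDerivAt_of_le
    (fun p => u p * pd v (1, 0) p - pd u (1, 0) p * v p)
    (fun p => u p * pd v (0, 1) p - pd u (0, 1) p * v p) _ _ (a, -M) (b, M)
    ⟨hab.le, by simp; linarith⟩ (hcF _) (hcF _)
    (fun p hp => hderiv _ p (hbox ⟨⟨hp.1.1.le, hp.2.1.le⟩, ⟨hp.1.2.le, hp.2.2.le⟩⟩))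
    (fun p hp => hderiv _ p (hbox ⟨⟨hp.1.1.le, hp.2.1.le⟩, ⟨hp.1.2.le, hp.2.2.le⟩⟩))
    (by simp only [hdiv]; exact hint (hcA.sub hcB))
  simp only [hdiv] at key
  have hMabs : M ≤ |M| := le_abs_self M
  have hMabs' : M ≤ |-M| := by rwa [abs_neg]
  rw [integral_sub (hint hcA) (hint hcB),
    ← setIntegral_strip_eq_Icc a b (fun p hp => by rw [hu2 _ p hp, hu2 _ p hp]; simp),
    ← setIntegral_strip_eq_Icc a b (fun p hp => by rw [hu0 p hp, zero_mul]),
    integral_eq_intervalIntegral_of_zero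
      (fun τ hτ => by rw [hu0 _ hτ, hu1 _ _ hτ]; simp),
    integral_eq_intervalIntegral_of_zero
      (fun τ hτ => by rw [hu0 _ hτ, hu1 _ _ hτ]; simp)] at key
  have hslice : ∀ c ∈ Icc a b,
      ∫ τ : ℝ, (u (c, τ) * pd v (1, 0) (c, τ) - pd u (1, 0) (c, τ) * v (c, τ)) =
      (∫ τ : ℝ, u (c, τ) * pd v (1, 0) (c, τ)) - ∫ τ : ℝ, pd u (1, 0) (c, τ) * v (c, τ) :=
    fun c hc => integral_sub
      (((hu.continuous_slice hab hc).mul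
        ((hv.dirDeriv _).continuous_slice hab hc)).integrable_of_hasCompactSupport
          (huc.slice c).mul_right)
      ((((hu.dirDeriv _).continuous_slice hab hc).mul
        (hv.continuous_slice hab hc)).integrable_of_hasCompactSupport
          ((huc.dirDeriv _).slice c).mul_right)
  rw [hslice b (right_mem_Icc.2 hab.le), hslice a (left_mem_Icc.2 hab.le)] at key
  simp only [hu0 (_, M) hMabs, hu0 (_, -M) hMabs', hu1 _ (_, M) hMabs, hu1 _ (_, -M) hMabs',
    zero_mul, sub_zero, intervalIntegral.integral_zero, zero_add] at key
  linear_combination key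

/-- Nonlocal Green formula on the strip `Π` (the plane-angle formula after `r = e^τ`). -/
theorem green_formula_nonlocal_strip
    (b₁ b₂ b₃ : ℝ) (hb₀ : 0 < b₁) (hb₁₂ : b₁ < b₂) (hb₂₃ : b₂ < b₃) (hb₃ : b₃ < 2 * π)
    (α χ₁₂ : ℝ) (hχ : 0 < χ₁₂)
    (u w₁ w₂ : ℝ × ℝ → ℂ)
    (hu : SmoothNear u (closure (strip b₁ b₃)))
    (huc : HasCompactSupport u)
    (hw₁ : SmoothNear w₁ (closure (strip b₁ b₂)))
    (hw₂ : SmoothNear w₂ (closure (strip b₂ b₃))) :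
    ((∫ p in strip b₁ b₂,
        (-(pd (pd u (1, 0)) (1, 0) p) - pd (pd u (0, 1)) (0, 1) p) * conj (w₁ p)) +
      (∫ p in strip b₂ b₃,
        (-(pd (pd u (1, 0)) (1, 0) p) - pd (pd u (0, 1)) (0, 1) p) * conj (w₂ p))) +
    (∫ τ : ℝ, (u (b₁, τ) + (α : ℂ) * u (b₂, τ + Real.log χ₁₂)) * conj (pd w₁ (1, 0) (b₁, τ))) +
    (∫ τ : ℝ, u (b₃, τ) * conj (-(pd w₂ (1, 0) (b₃, τ)))) +
    (∫ τ : ℝ, pd u (1, 0) (b₂, τ) * (conj (w₁ (b₂, τ)) - conj (w₂ (b₂, τ)))) =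
    ((∫ p in strip b₁ b₂,
        u p * conj (-(pd (pd w₁ (1, 0)) (1, 0) p) - pd (pd w₁ (0, 1)) (0, 1) p)) +
      (∫ p in strip b₂ b₃,
        u p * conj (-(pd (pd w₂ (1, 0)) (1, 0) p) - pd (pd w₂ (0, 1)) (0, 1) p))) +
    (∫ τ : ℝ, pd u (1, 0) (b₁, τ) * conj (w₁ (b₁, τ))) +
    (∫ τ : ℝ, (-(pd u (1, 0) (b₃, τ))) * conj (w₂ (b₃, τ))) +
    (∫ τ : ℝ, u (b₂, τ) * conj (pd w₁ (1, 0) (b₂, τ) - pd w₂ (1, 0) (b₂, τ) +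
      (α : ℂ) * pd w₁ (1, 0) (b₁, τ - Real.log χ₁₂))) := by
  have hu₁ : SmoothNear u (closure (strip b₁ b₂)) :=
    hu.mono (closure_mono (prod_mono_left (Ioo_subset_Ioo_right hb₂₃.le)))
  have hu₂ : SmoothNear u (closure (strip b₂ b₃)) :=
    hu.mono (closure_mono (prod_mono_left (Ioo_subset_Ioo_left hb₁₂.le)))
  have g₁ := green_formula_strip hb₁₂ hu₁ huc hw₁.star
  have g₂ := green_formula_strip hb₂₃ hu₂ huc hw₂.star
  simp only [pd_conj] at g₁ g₂
  have m1 : b₁ ∈ Icc b₁ b₂ := left_mem_Icc.2 hb₁₂.le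
  have m2 : b₂ ∈ Icc b₁ b₂ := right_mem_Icc.2 hb₁₂.le
  have m2' : b₂ ∈ Icc b₂ b₃ := left_mem_Icc.2 hb₂₃.le
  have hint : ∀ {f g : ℝ → ℂ}, Continuous f → HasCompactSupport f → Continuous g →
      Integrable fun τ => f τ * conj (g τ) := fun hf hfc hg =>
    (hf.mul (Complex.continuous_conj.comp hg)).integrable_of_hasCompactSupport hfc.mul_right
  have cu₁ := hu₁.continuous_slice hb₁₂ m1
  have cu₂ := hu₁.continuous_slice hb₁₂ m2
  have cdu₂ := (hu₁.dirDeriv (1, 0)).continuous_slice hb₁₂ m2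
  have cdw₁₁ := (hw₁.dirDeriv (1, 0)).continuous_slice hb₁₂ m1
  have cdw₁₂ := (hw₁.dirDeriv (1, 0)).continuous_slice hb₁₂ m2
  have cdw₂₂ := (hw₂.dirDeriv (1, 0)).continuous_slice hb₂₃ m2'
  have shift : ∫ τ : ℝ, u (b₂, τ + Real.log χ₁₂) * conj (pd w₁ (1, 0) (b₁, τ)) =
      ∫ τ : ℝ, u (b₂, τ) * conj (pd w₁ (1, 0) (b₁, τ - Real.log χ₁₂)) := by
    rw [← integral_add_right_eq_self
      (fun τ => u (b₂, τ) * conj (pd w₁ (1, 0) (b₁, τ - Real.log χ₁₂))) (Real.log χ₁₂)]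
    simp only [add_sub_cancel_right]
  have ishift' : Integrable fun τ : ℝ =>
      u (b₂, τ) * conj (pd w₁ (1, 0) (b₁, τ - Real.log χ₁₂)) :=
    hint cu₂ (huc.slice b₂) (cdw₁₁.comp (continuous_sub_right (Real.log χ₁₂)))
  have ishift : Integrable fun τ : ℝ =>
      u (b₂, τ + Real.log χ₁₂) * conj (pd w₁ (1, 0) (b₁, τ)) := by
    simpa only [add_sub_cancel_right] using ishift'.comp_add_right (Real.log χ₁₂)
  have e₁ : ∫ τ : ℝ, (u (b₁, τ) + (α : ℂ) * u (b₂, τ + Real.log χ₁₂)) *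
        conj (pd w₁ (1, 0) (b₁, τ)) =
      (∫ τ : ℝ, u (b₁, τ) * conj (pd w₁ (1, 0) (b₁, τ))) +
        α * ∫ τ : ℝ, u (b₂, τ) * conj (pd w₁ (1, 0) (b₁, τ - Real.log χ₁₂)) := by
    rw [← shift, ← integral_const_mul,
      ← integral_add (hint cu₁ (huc.slice b₁) cdw₁₁) (ishift.const_mul _)]
    exact integral_congr_ae (.of_forall fun τ => by ring)
  have e₂ : ∫ τ : ℝ, pd u (1, 0) (b₂, τ) * (conj (w₁ (b₂, τ)) - conj (w₂ (b₂, τ))) =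
      (∫ τ : ℝ, pd u (1, 0) (b₂, τ) * conj (w₁ (b₂, τ))) -
        ∫ τ : ℝ, pd u (1, 0) (b₂, τ) * conj (w₂ (b₂, τ)) := by
    rw [← integral_sub
      (hint cdu₂ ((huc.dirDeriv _).slice b₂) (hw₁.continuous_slice hb₁₂ m2))
      (hint cdu₂ ((huc.dirDeriv _).slice b₂) (hw₂.continuous_slice hb₂₃ m2'))]
    simp only [mul_sub]
  have e₃ : ∫ τ : ℝ, u (b₂, τ) * conj (pd w₁ (1, 0) (b₂, τ) - pd w₂ (1, 0) (b₂, τ) +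
        (α : ℂ) * pd w₁ (1, 0) (b₁, τ - Real.log χ₁₂)) =
      (∫ τ : ℝ, u (b₂, τ) * conj (pd w₁ (1, 0) (b₂, τ))) -
        (∫ τ : ℝ, u (b₂, τ) * conj (pd w₂ (1, 0) (b₂, τ))) +
        α * ∫ τ : ℝ, u (b₂, τ) * conj (pd w₁ (1, 0) (b₁, τ - Real.log χ₁₂)) := by
    have i₁ := hint cu₂ (huc.slice b₂) cdw₁₂
    have i₂ := hint cu₂ (huc.slice b₂) cdw₂₂
    have i₁₂ : Integrable fun τ : ℝ => u (b₂, τ) * conj (pd w₁ (1, 0) (b₂, τ)) -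
        u (b₂, τ) * conj (pd w₂ (1, 0) (b₂, τ)) := i₁.sub i₂
    rw [← integral_const_mul, ← integral_sub i₁ i₂, ← integral_add i₁₂ (ishift'.const_mul _)]
    refine integral_congr_ae (.of_forall fun τ => ?_)
    simp only [map_add, map_sub, map_mul, Complex.conj_ofReal]
    ring
  rw [e₁, e₂, e₃]
  simp only [map_sub, map_neg, mul_neg, neg_mul, integral_neg]
  linear_combination g₁ + g₂
end
end
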